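/- Let p < q be primes and let ĩ ≤ i be positive integers. If property P₂ holds for m = p^i·q, then property P₂ also holds for m̃ = p^ĩ·q. -/

import Mathlib

open Polynomial

/-- Property `P₂` for `m`: every squarefree polynomial `f ∈ 𝔽₂[X]` of degree `m`
whose order `o(f)` (the least positive `n` with `f ∣ X^(2^n) - X`) equals `m` is
irreducible. -/
def P2 (m : ℕ) : Prop :=
  ∀ f : Polynomial (ZMod 2), Squarefree f → f.natDegree = m →
    IsLeast {n : ℕ | 0 < n ∧ f ∣ X ^ 2 ^ n - X} m → Irreducible f

open UniqueFactorizationMonoid Finset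

lemma Irreducible.dvd_X_pow_two_pow_sub_X_iff {g : (ZMod 2)[X]} (hg : Irreducible g) (n : ℕ) :
    g ∣ X ^ 2 ^ n - X ↔ g.natDegree ∣ n := by
  have := hg.natDegree_dvd_iff_dvd_X_pow_card_pow_sub_X (n := n)
  rw [Nat.card_zmod] at this
  exact this.symm

lemma X_pow_two_pow_sub_X_ne_zero {n : ℕ} (hn : n ≠ 0) : (X ^ 2 ^ n - X : (ZMod 2)[X]) ≠ 0 :=
  FiniteField.X_pow_card_pow_sub_X_ne_zero _ hn one_lt_two

lemma natDegree_X_pow_two_pow_sub_X {n : ℕ} (hn : n ≠ 0) :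
    (X ^ 2 ^ n - X : (ZMod 2)[X]).natDegree = 2 ^ n :=
  FiniteField.X_pow_card_pow_sub_X_natDegree_eq _ hn one_lt_two

lemma squarefree_X_pow_two_pow_sub_X {n : ℕ} (hn : n ≠ 0) :
    Squarefree (X ^ 2 ^ n - X : (ZMod 2)[X]) :=
  (galois_poly_separable 2 _ (dvd_pow_self 2 hn)).squarefree

/-- Distinct monic irreducible polynomials are relatively prime. -/
lemma pairwise_isRelPrime_of_monic_irreducible {T : Finset (ZMod 2)[X]}
    (hT : ∀ g ∈ T, g.Monic ∧ Irreducible g) : (T : Set (ZMod 2)[X]).Pairwise IsRelPrime := by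
  intro g hg h hh hne
  rw [(hT g hg).2.isRelPrime_iff_not_dvd]
  exact fun hd => hne <| eq_of_monic_of_associated (hT g hg).1 (hT h hh).1
    ((hT g hg).2.associated_of_dvd (hT h hh).2 hd)

lemma prod_dvd_X_pow_two_pow_sub_X_iff {T : Finset (ZMod 2)[X]}
    (hT : ∀ g ∈ T, g.Monic ∧ Irreducible g) (n : ℕ) :
    ∏ g ∈ T, g ∣ X ^ 2 ^ n - X ↔ ∀ g ∈ T, g.natDegree ∣ n := by
  refine ⟨fun h g hg => ?_, fun h => ?_⟩
  · exact ((hT g hg).2.dvd_X_pow_two_pow_sub_X_iff n).1 ((dvd_prod_of_mem (fun g => g) hg).trans h)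
  · refine prod_dvd_of_isRelPrime (s := id) (pairwise_isRelPrime_of_monic_irreducible hT)
      fun g hg => ?_
    rw [id_eq, (hT g hg).2.dvd_X_pow_two_pow_sub_X_iff n]
    exact h g hg

lemma monic_irreducible_of_mem_primeFactors {f g : (ZMod 2)[X]} (hg : g ∈ primeFactors f) :
    g.Monic ∧ Irreducible g := by
  rw [mem_primeFactors] at hg
  have hirr := irreducible_of_normalized_factor g hg
  refine ⟨?_, hirr⟩
  rw [← normalize_normalized_factor g hg]
  exact monic_normalize hirr.ne_zero

/-- The finset of monic irreducible polynomials of degree `n` over `𝔽₂`, for `n ≠ 0`. -/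
noncomputable def monicIrreducibles (n : ℕ) : Finset (ZMod 2)[X] :=
  {g ∈ primeFactors (X ^ 2 ^ n - X : (ZMod 2)[X]) | g.natDegree = n}

lemma mem_monicIrreducibles {n : ℕ} (hn : n ≠ 0) {g : (ZMod 2)[X]} :
    g ∈ monicIrreducibles n ↔ (g.Monic ∧ Irreducible g) ∧ g.natDegree = n := by
  rw [monicIrreducibles, mem_filter]
  refine and_congr_left fun hdeg => ⟨monic_irreducible_of_mem_primeFactors, fun hg => ?_⟩
  rw [mem_primeFactors, mem_normalizedFactors_iff' (X_pow_two_pow_sub_X_ne_zero hn)]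
  exact ⟨hg.2, hg.1.normalize_eq_self, (hg.2.dvd_X_pow_two_pow_sub_X_iff n).2 hdeg.dvd⟩

lemma natDegree_prod_monicIrreducibles {n : ℕ} (hn : n ≠ 0) :
    (∏ g ∈ monicIrreducibles n, g).natDegree = n * #(monicIrreducibles n) := by
  rw [natDegree_prod_of_monic _ _ fun g hg => ((mem_monicIrreducibles hn).1 hg).1.1,
    sum_congr rfl fun g hg => ((mem_monicIrreducibles hn).1 hg).2, sum_const, smul_eq_mul,
    mul_comm]

lemma mul_card_monicIrreducibles_le {n : ℕ} (hn : n ≠ 0) :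
    n * #(monicIrreducibles n) ≤ 2 ^ n := by
  rw [← natDegree_prod_monicIrreducibles hn, ← natDegree_X_pow_two_pow_sub_X hn]
  refine natDegree_le_of_dvd ?_ (X_pow_two_pow_sub_X_ne_zero hn)
  rw [prod_dvd_X_pow_two_pow_sub_X_iff fun g hg => ((mem_monicIrreducibles hn).1 hg).1]
  exact fun g hg => ((mem_monicIrreducibles hn).1 hg).2.dvd

lemma le_mul_card_monicIrreducibles {n : ℕ} (hn : n ≠ 0) :
    2 ^ n + 2 ≤ n * #(monicIrreducibles n) + 2 ^ (n / 2 + 1) := by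
  set B : (ZMod 2)[X] := ∏ k ∈ range (n / 2), (X ^ 2 ^ (k + 1) - X) with hB
  have hB0 : B ≠ 0 := prod_ne_zero_iff.2 fun k _ => X_pow_two_pow_sub_X_ne_zero k.succ_ne_zero
  have hBdeg : B.natDegree + 2 = 2 ^ (n / 2 + 1) := by
    rw [hB, natDegree_prod _ _ fun k _ => X_pow_two_pow_sub_X_ne_zero k.succ_ne_zero,
      sum_congr rfl fun k _ => natDegree_X_pow_two_pow_sub_X k.succ_ne_zero]
    induction n / 2 with
    | zero => rfl
    | succ m ih => rw [sum_range_succ, pow_succ _ (m + 1)]; omega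
  have hS0 : ∏ g ∈ monicIrreducibles n, g ≠ 0 :=
    prod_ne_zero_iff.2 fun g hg => ((mem_monicIrreducibles hn).1 hg).1.2.ne_zero
  have hdvd : (X ^ 2 ^ n - X : (ZMod 2)[X]) ∣ (∏ g ∈ monicIrreducibles n, g) * B := by
    refine ((squarefree_X_pow_two_pow_sub_X hn).isRadical.dvd_radical
      (X_pow_two_pow_sub_X_ne_zero hn)).trans ?_
    refine prod_dvd_of_isRelPrime pairwise_primeFactors_isRelPrime fun g hg => ?_
    have hgi := monic_irreducible_of_mem_primeFactors hg
    rw [mem_primeFactors] at hg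
    obtain ⟨c, hc⟩ := (hgi.2.dvd_X_pow_two_pow_sub_X_iff n).1 (dvd_of_mem_normalizedFactors hg)
    have hpos := hgi.2.natDegree_pos
    obtain hdeg | hdeg := eq_or_ne g.natDegree n
    · exact (dvd_prod_of_mem id ((mem_monicIrreducibles hn).2 ⟨hgi, hdeg⟩)).mul_right _
    · have hc2 : 2 ≤ c := by
        rcases c with _ | _ | c <;> omega
      have hle : g.natDegree ≤ n / 2 := by
        rw [Nat.le_div_iff_mul_le two_pos, hc]
        exact Nat.mul_le_mul_left _ hc2
      have hlt : g.natDegree - 1 < n / 2 := by omega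
      have hgd : g ∣ X ^ 2 ^ (g.natDegree - 1 + 1) - X := by
        rw [hgi.2.dvd_X_pow_two_pow_sub_X_iff, Nat.sub_add_cancel hpos]
      have hmem := dvd_prod_of_mem (fun k => (X ^ 2 ^ (k + 1) - X : (ZMod 2)[X]))
        (mem_range.2 hlt)
      rw [id_eq]
      exact (hgd.trans hmem).mul_left _
  have hle := natDegree_le_of_dvd hdvd (mul_ne_zero hS0 hB0)
  rw [natDegree_X_pow_two_pow_sub_X hn, natDegree_mul hS0 hB0,
    natDegree_prod_monicIrreducibles hn] at hle
  omega

lemma monicIrreducibles_nonempty {n : ℕ} (hn : n ≠ 0) : (monicIrreducibles n).Nonempty := by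
  rw [nonempty_iff_ne_empty]
  intro h
  have h1 := le_mul_card_monicIrreducibles hn
  have h2 : 2 ^ (n / 2 + 1) ≤ 2 ^ n := Nat.pow_le_pow_right two_pos (by omega)
  rw [h, card_empty] at h1
  omega

lemma mul_two_pow_add_le {p d : ℕ} (hp : 2 ≤ p) (hd : d ≠ 0) (hpd : ¬(p = 2 ∧ d = 1)) :
    p * 2 ^ d + 2 ^ (p * d / 2 + 1) ≤ 2 ^ (p * d) + 2 := by
  by_cases h31 : p = 3 ∧ d = 1
  · obtain ⟨rfl, rfl⟩ := h31
    norm_num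
  have key : p * 2 ^ d ≤ 2 ^ (p * d - 1) ∧ 4 ≤ p * d := by
    obtain rfl | hd1 := eq_or_ne d 1
    · obtain ⟨k, rfl⟩ := Nat.exists_eq_add_of_le (show 4 ≤ p by omega)
      refine ⟨?_, by omega⟩
      have h : k < 2 ^ k := Nat.lt_two_pow_self
      rw [show (4 + k) * 1 - 1 = k + 3 by omega, pow_add]
      omega
    · have hd2 : 2 ≤ d := by omega
      have h1 : p ≤ 2 ^ (p - 1) := by
        have : p - 1 < 2 ^ (p - 1) := Nat.lt_two_pow_self
        omega
      refine ⟨?_, Nat.mul_le_mul hp hd2⟩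
      calc p * 2 ^ d ≤ 2 ^ (p - 1) * 2 ^ d := Nat.mul_le_mul_right _ h1
        _ = 2 ^ (p - 1 + d) := (pow_add _ _ _).symm
        _ ≤ 2 ^ (p * d - 1) := Nat.pow_le_pow_right two_pos (by
          have : p + d ≤ p * d := by nlinarith
          omega)
  have h2 : 2 ^ (p * d / 2 + 1) ≤ 2 ^ (p * d - 1) :=
    Nat.pow_le_pow_right two_pos (by omega)
  have h3 : 2 ^ (p * d) = 2 ^ (p * d - 1) * 2 := by
    rw [← pow_succ]
    congr 1
    omega
  omega

lemma card_monicIrreducibles_le_mul {p d : ℕ} (hp : 2 ≤ p) (hd : d ≠ 0)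
    (hpd : ¬(p = 2 ∧ d = 1)) : #(monicIrreducibles d) ≤ #(monicIrreducibles (p * d)) := by
  have hpd0 : p * d ≠ 0 := mul_ne_zero (by omega) hd
  have h1 := Nat.mul_le_mul_left p (mul_card_monicIrreducibles_le hd)
  have h2 := le_mul_card_monicIrreducibles hpd0
  have h3 := mul_two_pow_add_le hp hd hpd
  rw [← mul_assoc] at h1
  refine Nat.le_of_mul_le_mul_left (?_ : p * d * _ ≤ p * d * _) (Nat.pos_of_ne_zero hpd0)
  omega

/-- A degree-multiplying map on monic irreducible polynomials, injective except possibly when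
degree `1` is sent to degree `2`. -/
lemma exists_map_monicIrreducibles {p : ℕ} (hp : 2 ≤ p) :
    ∃ φ : (ZMod 2)[X] → (ZMod 2)[X],
      (∀ g, Irreducible g →
        ((φ g).Monic ∧ Irreducible (φ g)) ∧ (φ g).natDegree = p * g.natDegree) ∧
      ∀ g h, g.Monic ∧ Irreducible g → h.Monic ∧ Irreducible h → φ g = φ h →
        g = h ∨ (p = 2 ∧ g.natDegree = 1 ∧ h.natDegree = 1) := by
  classical
  have key : ∀ d : ℕ, d ≠ 0 → ∃ ψ : (ZMod 2)[X] → (ZMod 2)[X],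
      (∀ g, ψ g ∈ monicIrreducibles (p * d)) ∧
      (Set.InjOn ψ (monicIrreducibles d) ∨ (p = 2 ∧ d = 1)) := by
    intro d hd
    obtain ⟨r, hr⟩ := monicIrreducibles_nonempty (mul_ne_zero (by omega : p ≠ 0) hd)
    by_cases hpd : p = 2 ∧ d = 1
    · exact ⟨fun _ => r, fun _ => hr, Or.inr hpd⟩
    · obtain ⟨e⟩ := Function.Embedding.nonempty_of_card_le
        (α := monicIrreducibles d) (β := monicIrreducibles (p * d))
        (by simpa using card_monicIrreducibles_le_mul hp hd hpd)
      refine ⟨fun g => if hg : g ∈ monicIrreducibles d then e ⟨g, hg⟩ else r, fun g => ?_,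
        Or.inl fun g hg h hh hgh => ?_⟩
      · dsimp only
        split_ifs with hg
        exacts [(e ⟨g, hg⟩).2, hr]
      · rw [mem_coe] at hg hh
        simpa [hg, hh] using hgh
  choose! ψ hψ using key
  have hφ : ∀ g, Irreducible g →
      ((ψ g.natDegree g).Monic ∧ Irreducible (ψ g.natDegree g)) ∧
        (ψ g.natDegree g).natDegree = p * g.natDegree := fun g hg =>
    (mem_monicIrreducibles (mul_ne_zero (by omega) hg.natDegree_pos.ne')).1
      ((hψ _ hg.natDegree_pos.ne').1 g)
  refine ⟨fun g => ψ g.natDegree g, hφ, fun g h hg hh hgh => ?_⟩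
  have hdeg : g.natDegree = h.natDegree := by
    have := congrArg natDegree hgh
    rw [(hφ g hg.2).2, (hφ h hh.2).2] at this
    exact Nat.eq_of_mul_eq_mul_left (by omega) this
  have h0 := hg.2.natDegree_pos.ne'
  obtain hinj | hpd := (hψ _ h0).2
  · refine Or.inl (hinj (mem_coe.2 ((mem_monicIrreducibles h0).2 ⟨hg, rfl⟩))
      (mem_coe.2 ((mem_monicIrreducibles h0).2 ⟨hh, hdeg.symm⟩)) ?_)
    dsimp only at hgh
    rw [hgh, hdeg]
  · exact Or.inr ⟨hpd.1, hpd.2, hdeg ▸ hpd.2⟩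

/-- There are only two polynomials of degree one over `𝔽₂`. -/
lemma eq_or_eq_of_natDegree_eq_one {g h u : (ZMod 2)[X]} (hg : g.Monic) (hh : h.Monic)
    (hu : u.Monic) (hg1 : g.natDegree = 1) (hh1 : h.natDegree = 1) (hu1 : u.natDegree = 1)
    (hgh : g ≠ h) : u = g ∨ u = h := by
  rw [hg.eq_X_add_C hg1, hh.eq_X_add_C hh1, hu.eq_X_add_C hu1] at *
  generalize g.coeff 0 = a at *
  generalize h.coeff 0 = b at *
  generalize u.coeff 0 = c at *
  simp only [ne_eq, add_right_inj, C_inj] at hgh ⊢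
  clear * - hgh
  revert a b c
  decide

lemma exists_finset_scaling_natDegree {p : ℕ} (hp : 2 ≤ p) {T : Finset (ZMod 2)[X]}
    (hT : ∀ g ∈ T, g.Monic ∧ Irreducible g) (hcard : 1 < #T) :
    ∃ T' : Finset (ZMod 2)[X], (∀ g ∈ T', g.Monic ∧ Irreducible g) ∧ 1 < #T' ∧
      ∑ g ∈ T', g.natDegree = p * ∑ g ∈ T, g.natDegree ∧
      ∀ n, (∀ g ∈ T', g.natDegree ∣ n) ↔ ∀ g ∈ T, p * g.natDegree ∣ n := by
  classical
  obtain ⟨φ, hφ, hinj⟩ := exists_map_monicIrreducibles hp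
  have hsum : ∀ S ⊆ T, Set.InjOn φ S →
      ∑ g ∈ S.image φ, g.natDegree = p * ∑ g ∈ S, g.natDegree := by
    intro S hS hSinj
    rw [sum_image hSinj, mul_sum]
    exact sum_congr rfl fun g hg => (hφ g (hT g (hS hg)).2).2
  by_cases hTinj : Set.InjOn φ T
  · refine ⟨T.image φ, ?_, ?_, hsum T subset_rfl hTinj, fun n => ?_⟩
    · rw [forall_mem_image]
      exact fun g hg => (hφ g (hT g hg).2).1
    · rwa [card_image_of_injOn hTinj]
    · rw [forall_mem_image]
      exact forall₂_congr fun g hg => by rw [(hφ g (hT g hg).2).2]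
  -- Here `p = 2`, and `X`, `X + 1` both lie in `T`.
  simp only [Set.InjOn, not_forall] at hTinj
  obtain ⟨g, hg, h, hh, hgh, hne⟩ := hTinj
  rw [mem_coe] at hg hh
  obtain ⟨rfl, hg1, hh1⟩ := (hinj g h (hT g hg) (hT h hh) hgh).resolve_left hne
  have hinj' : Set.InjOn φ (T.erase h : Finset (ZMod 2)[X]) := by
    intro u hu v hv huv
    rw [mem_coe, mem_erase] at hu hv
    refine (hinj u v (hT u hu.2) (hT v hv.2) huv).elim id fun ⟨_, hu1, hv1⟩ => ?_
    rw [(eq_or_eq_of_natDegree_eq_one (hT g hg).1 (hT h hh).1 (hT u hu.2).1 hg1 hh1 hu1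
        hne).resolve_right hu.1,
      (eq_or_eq_of_natDegree_eq_one (hT g hg).1 (hT h hh).1 (hT v hv.2).1 hg1 hh1 hv1
        hne).resolve_right hv.1]
  have hdisj : Disjoint ({g, h} : Finset (ZMod 2)[X]) ((T.erase h).image φ) := by
    rw [disjoint_right, forall_mem_image]
    intro u hu hmem
    have hdeg := (hφ u (hT u (mem_of_mem_erase hu)).2).2
    rw [mem_insert, mem_singleton] at hmem
    rcases hmem with hu' | hu' <;> rw [hu'] at hdeg <;> omega
  refine ⟨{g, h} ∪ (T.erase h).image φ, ?_, ?_, ?_, fun n => ?_⟩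
  · intro u hu
    simp only [mem_union, mem_insert, mem_singleton, mem_image] at hu
    rcases hu with (rfl | rfl) | ⟨v, hv, rfl⟩
    exacts [hT _ hg, hT _ hh, (hφ v (hT v (mem_of_mem_erase hv)).2).1]
  · refine lt_of_lt_of_le ?_ (card_le_card subset_union_left)
    rw [card_pair hne]
    exact one_lt_two
  · rw [sum_union hdisj, sum_pair hne, hsum _ (erase_subset h T) hinj', hg1, hh1,
      ← add_sum_erase T _ hh, hh1]
    ring
  · constructor
    · intro H u hu
      have hmem : ∀ v ∈ T.erase h, 2 * v.natDegree ∣ n := fun v hv =>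
        (hφ v (hT v (mem_of_mem_erase hv)).2).2 ▸
          H (φ v) (mem_union_right _ (mem_image_of_mem φ hv))
      obtain rfl | huh := eq_or_ne u h
      · rw [hh1, ← hg1]
        exact hmem g (mem_erase.2 ⟨hne, hg⟩)
      · exact hmem u (mem_erase.2 ⟨huh, hu⟩)
    · intro H u hu
      simp only [mem_union, mem_insert, mem_singleton, mem_image] at hu
      rcases hu with (rfl | rfl) | ⟨v, hv, rfl⟩
      · simp [hg1]
      · simp [hh1]
      · rw [(hφ v (hT v (mem_of_mem_erase hv)).2).2]
        exact H v (mem_of_mem_erase hv)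

lemma P2.of_mul {p m : ℕ} (hp : 2 ≤ p) (hm : 0 < m) (h : P2 (p * m)) : P2 m := by
  intro f hf hdeg hord
  by_contra hirr
  set T := primeFactors f with hTdef
  have hT : ∀ g ∈ T, g.Monic ∧ Irreducible g := fun _ => monic_irreducible_of_mem_primeFactors
  have hassoc : Associated (∏ g ∈ T, g) f := radical_associated hf.isRadical hf.ne_zero
  have hsum : ∑ g ∈ T, g.natDegree = m := by
    rw [← hdeg, ← natDegree_eq_of_degree_eq (degree_eq_degree_of_associated hassoc),
      natDegree_prod_of_monic _ _ fun g hg => (hT g hg).1]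
  have hdvd : ∀ n, f ∣ X ^ 2 ^ n - X ↔ ∀ g ∈ T, g.natDegree ∣ n := fun n => by
    rw [← hassoc.dvd_iff_dvd_left, prod_dvd_X_pow_two_pow_sub_X_iff hT]
  have hne : T.Nonempty := by
    rw [nonempty_iff_ne_empty]
    intro h0
    rw [h0, sum_empty] at hsum
    omega
  have hcard : 1 < #T := by
    by_contra hle
    obtain ⟨g, hg⟩ := card_eq_one.1 (le_antisymm (not_lt.1 hle) hne.card_pos)
    rw [hg, prod_singleton] at hassoc
    exact hirr (hassoc.irreducible (hT g (hg ▸ mem_singleton_self g)).2)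
  obtain ⟨T', hT', hcard', hsum', hdvd'⟩ := exists_finset_scaling_natDegree hp hT hcard
  have hirr' : Irreducible (∏ g ∈ T', g) := by
    refine h _ ?_ ?_ ⟨⟨Nat.mul_pos (by omega) hm, ?_⟩, ?_⟩
    · exact squarefree_prod_of_pairwise_isCoprime
        (pairwise_isRelPrime_of_monic_irreducible hT') fun g hg => (hT' g hg).2.squarefree
    · rw [natDegree_prod_of_monic _ _ fun g hg => (hT' g hg).1, hsum', hsum]
    · rw [prod_dvd_X_pow_two_pow_sub_X_iff hT', hdvd']
      exact fun g hg => Nat.mul_dvd_mul_left p ((hdvd m).1 hord.1.2 g hg)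
    · rintro n ⟨hn, hn'⟩
      rw [prod_dvd_X_pow_two_pow_sub_X_iff hT', hdvd'] at hn'
      obtain ⟨g, hg⟩ := hne
      obtain ⟨k, rfl⟩ := (dvd_mul_right p _).trans (hn' g hg)
      refine Nat.mul_le_mul_left p (hord.2 ⟨Nat.pos_of_mul_pos_left hn, (hdvd k).2 ?_⟩)
      exact fun u hu => Nat.dvd_of_mul_dvd_mul_left (by omega) (hn' u hu)
  obtain ⟨g, hg, u, hu, hgu⟩ := one_lt_card.1 hcard'
  have hg' := (hT' g hg).2.associated_of_dvd hirr' (dvd_prod_of_mem _ hg)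
  have hu' := (hT' u hu).2.associated_of_dvd hirr' (dvd_prod_of_mem _ hu)
  exact hgu (eq_of_monic_of_associated (hT' g hg).1 (hT' u hu).1 (hg'.trans hu'.symm))

/-- For primes `p < q` and positive integers `i' ≤ i` (here `i'` plays
the role of `ĩ`), if `P₂` holds for `m = p^i * q` then it also holds for
`m̃ = p^i' * q`. -/
theorem stmt_6 (p q i i' : ℕ) (hp : p.Prime) (hq : q.Prime) (hpq : p < q)
    (hi' : 0 < i') (hle : i' ≤ i) (h : P2 (p ^ i * q)) : P2 (p ^ i' * q) := by
  induction i, hle using Nat.le_induction with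
  | base => exact h
  | succ k _ ih =>
    rw [pow_succ', mul_assoc] at h
    exact ih (h.of_mul hp.two_le (Nat.mul_pos (pow_pos hp.pos k) hq.pos))
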